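/- Let 𝒞 be a triangulated category with a proper class ξ of triangles and enough ξ-projectives. Given a ξ-exact sequence 0 → B → G₁ → G₀ → A → 0 with G₁, G₀ ∈ 𝒢𝒫(ξ), there exists a ξ-exact sequence 0 → B → P → G₀′ → A → 0 with P ξ-projective and G₀′ ∈ 𝒢𝒫(ξ). -/

import Mathlib

open CategoryTheory CategoryTheory.Limits CategoryTheory.Pretriangulated

namespace GorensteinTriangulated

variable {C : Type*} [Category C] [HasZeroObject C] [HasShift C ℤ] [Preadditive C]
  [∀ n : ℤ, (shiftFunctor C n).Additive] [Pretriangulated C]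

/-- A triangle `A ⟶ B ⟶ C ⟶ ΣA` is split if it is isomorphic to the triangle
`A ⟶ A ⊞ C ⟶ C ⟶ ΣA` with structure maps `(1 0)`, `(0 1)ᵀ` and `0`. -/
def IsSplitTriangle (T : Triangle C) : Prop :=
  Nonempty (T ≅ Triangle.mk (biprod.inl : T.obj₁ ⟶ T.obj₁ ⊞ T.obj₃) biprod.snd
    (0 : T.obj₃ ⟶ T.obj₁⟦(1 : ℤ)⟧))

/-- The triangle `T` becomes a short exact sequence after applying `Hom(Q, -)`. -/
def CoExact (T : Triangle C) (Q : C) : Prop :=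
  Function.Injective (fun φ : Q ⟶ T.obj₁ => φ ≫ T.mor₁) ∧
  (∀ φ : Q ⟶ T.obj₂, φ ≫ T.mor₂ = 0 → ∃ ψ : Q ⟶ T.obj₁, φ = ψ ≫ T.mor₁) ∧
  Function.Surjective (fun φ : Q ⟶ T.obj₂ => φ ≫ T.mor₂)

/-- The triangle `T` becomes a short exact sequence after applying `Hom(-, Q)`. -/
def ContraExact (T : Triangle C) (Q : C) : Prop :=
  Function.Injective (fun φ : T.obj₃ ⟶ Q => T.mor₂ ≫ φ) ∧
  (∀ φ : T.obj₂ ⟶ Q, T.mor₁ ≫ φ = 0 → ∃ ψ : T.obj₃ ⟶ Q, φ = T.mor₂ ≫ ψ) ∧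
  Function.Surjective (fun φ : T.obj₂ ⟶ Q => T.mor₁ ≫ φ)

/-- Saturation of a class of triangles with respect to base change: in a base change
diagram, if the third vertical triangle and the second horizontal triangle are in `S`,
then the original triangle is in `S`. -/
def SaturatedBase (S : Set (Triangle C)) : Prop :=
  ∀ T ∈ (distinguishedTriangles : Set (Triangle C)),
    ∀ (M G E : C) (α : M ⟶ G) (δ : M ⟶ E) (f' : T.obj₁ ⟶ G) (g' : G ⟶ E)
      (h' : E ⟶ T.obj₁⟦(1 : ℤ)⟧) (β : G ⟶ T.obj₂) (ε : E ⟶ T.obj₃)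
      (γ : T.obj₂ ⟶ M⟦(1 : ℤ)⟧) (ζ : T.obj₃ ⟶ M⟦(1 : ℤ)⟧),
      Triangle.mk α β γ ∈ (distinguishedTriangles : Set (Triangle C)) →
      Triangle.mk f' g' h' ∈ S → Triangle.mk δ ε ζ ∈ S →
      α ≫ g' = δ → f' ≫ β = T.mor₁ → g' ≫ ε = β ≫ T.mor₂ → h' = ε ≫ T.mor₃ →
      T.mor₂ ≫ ζ = γ → T ∈ S

/-- Saturation of a class of triangles with respect to cobase change: in a cobase change
diagram, if the second vertical triangle and the third horizontal triangle are in `S`,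
then the original triangle is in `S`. -/
def SaturatedCobase (S : Set (Triangle C)) : Prop :=
  ∀ T ∈ (distinguishedTriangles : Set (Triangle C)),
    ∀ (N D F : C) (ζ : N ⟶ T.obj₁) (δ : N ⟶ T.obj₂) (α : T.obj₁ ⟶ D) (β : T.obj₂ ⟶ F)
      (f' : D ⟶ F) (g' : F ⟶ T.obj₃) (h' : T.obj₃ ⟶ D⟦(1 : ℤ)⟧)
      (η : D ⟶ N⟦(1 : ℤ)⟧) (υ : F ⟶ N⟦(1 : ℤ)⟧),
      Triangle.mk ζ α η ∈ (distinguishedTriangles : Set (Triangle C)) →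
      Triangle.mk δ β υ ∈ S → Triangle.mk f' g' h' ∈ S →
      ζ ≫ T.mor₁ = δ → T.mor₁ ≫ β = α ≫ f' → T.mor₂ = β ≫ g' →
      T.mor₃ ≫ (shiftFunctor C (1 : ℤ)).map α = h' → f' ≫ υ = η → T ∈ S

/-- A proper class of triangles in the sense of Beligiannis. -/
structure IsProperClass (S : Set (Triangle C)) : Prop where
  subset_dist : S ⊆ (distinguishedTriangles : Set (Triangle C))
  split_mem : ∀ T : Triangle C, T ∈ (distinguishedTriangles : Set (Triangle C)) →
    IsSplitTriangle T → T ∈ S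
  iso_closed : ∀ T₁ T₂ : Triangle C, Nonempty (T₁ ≅ T₂) → T₁ ∈ S → T₂ ∈ S
  sum_closed : ∀ T₁ ∈ S, ∀ T₂ ∈ S, ∀ T ∈ (distinguishedTriangles : Set (Triangle C)),
    Nonempty (T.obj₁ ≅ T₁.obj₁ ⊞ T₂.obj₁) →
    (∀ e₁ : T.obj₁ ≅ T₁.obj₁ ⊞ T₂.obj₁, ∀ e₂ : T.obj₂ ≅ T₁.obj₂ ⊞ T₂.obj₂,
      ∀ e₃ : T.obj₃ ≅ T₁.obj₃ ⊞ T₂.obj₃,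
      T.mor₁ = e₁.hom ≫ biprod.map T₁.mor₁ T₂.mor₁ ≫ e₂.inv →
      T.mor₂ = e₂.hom ≫ biprod.map T₁.mor₂ T₂.mor₂ ≫ e₃.inv →
      T.mor₃ = e₃.hom ≫ biprod.desc
        (T₁.mor₃ ≫ (shiftFunctor C (1 : ℤ)).map (biprod.inl ≫ e₁.inv))
        (T₂.mor₃ ≫ (shiftFunctor C (1 : ℤ)).map (biprod.inr ≫ e₁.inv)) → T ∈ S)
  susp_closed : ∀ T ∈ S, ∀ i : ℤ, (Triangle.shiftFunctor C i).obj T ∈ S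
  saturated : SaturatedBase S
  base_change : ∀ T ∈ S, ∀ {E : C} (ε : E ⟶ T.obj₃),
    ∃ (G : C) (f' : T.obj₁ ⟶ G) (g' : G ⟶ E) (h' : E ⟶ T.obj₁⟦(1 : ℤ)⟧) (β : G ⟶ T.obj₂),
      Triangle.mk f' g' h' ∈ S ∧ f' ≫ β = T.mor₁ ∧ g' ≫ ε = β ≫ T.mor₂ ∧ h' = ε ≫ T.mor₃
  cobase_change : ∀ T ∈ S, ∀ {D : C} (α : T.obj₁ ⟶ D),
    ∃ (F : C) (f' : D ⟶ F) (g' : F ⟶ T.obj₃) (h' : T.obj₃ ⟶ D⟦(1 : ℤ)⟧) (β : T.obj₂ ⟶ F),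
      Triangle.mk f' g' h' ∈ S ∧ T.mor₁ ≫ β = α ≫ f' ∧ T.mor₂ = β ≫ g' ∧
      T.mor₃ ≫ (shiftFunctor C (1 : ℤ)).map α = h'

/-- `P` is a `ξ`-projective object. -/
def XiProjective (S : Set (Triangle C)) (P : C) : Prop :=
  ∀ T ∈ S, CoExact T P

/-- `𝒞` has enough `ξ`-projectives. -/
def HasEnoughXiProjectives (S : Set (Triangle C)) : Prop :=
  ∀ A : C, ∃ (K P : C) (f : K ⟶ P) (g : P ⟶ A) (h : A ⟶ K⟦(1 : ℤ)⟧),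
    XiProjective S P ∧ Triangle.mk f g h ∈ S

/-- The objects admitting a complete resolution by triangles in `S` with middle terms in
`X` which are `Hom(-, Y)`-exact; `GClass S X X` is the Gorenstein category `𝒢(X)` and
`GClass S (XiProjective S) (XiProjective S)` is the class of `ξ`-Gorenstein projectives. -/
def GClass (S : Set (Triangle C)) (X Y : C → Prop) (A : C) : Prop :=
  ∃ (K P : ℤ → C) (f : ∀ n : ℤ, K (n + 1) ⟶ P n) (g : ∀ n : ℤ, P n ⟶ K n)
    (h : ∀ n : ℤ, K n ⟶ (K (n + 1))⟦(1 : ℤ)⟧),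
    K 0 = A ∧ ∀ n : ℤ, X (P n) ∧ Triangle.mk (f n) (g n) (h n) ∈ S ∧
      ∀ Q : C, Y Q → ContraExact (Triangle.mk (f n) (g n) (h n)) Q

/-- `ξ`-Gorenstein projective objects. -/
def GProjective (S : Set (Triangle C)) (A : C) : Prop :=
  GClass S (XiProjective S) (XiProjective S) A

/-- A `ξ`-exact resolution `⋯ → X₁ → X₀ → A → 0` with terms satisfying `X`, which is
`Hom(-, Q)`-exact for every `Q` satisfying `Y`. -/
def HasResolution (S : Set (Triangle C)) (X Y : C → Prop) (A : C) : Prop :=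
  ∃ (K G : ℕ → C) (f : ∀ n : ℕ, K (n + 1) ⟶ G n) (g : ∀ n : ℕ, G n ⟶ K n)
    (h : ∀ n : ℕ, K n ⟶ (K (n + 1))⟦(1 : ℤ)⟧),
    K 0 = A ∧ ∀ n : ℕ, X (G n) ∧ Triangle.mk (f n) (g n) (h n) ∈ S ∧
      ∀ Q : C, Y Q → ContraExact (Triangle.mk (f n) (g n) (h n)) Q

/-- A `ξ`-exact coresolution `0 → A → X⁰ → X¹ → ⋯` with terms satisfying `X`, which is
`Hom(-, Q)`-exact for every `Q` satisfying `Y`. -/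
def HasCoresolution (S : Set (Triangle C)) (X Y : C → Prop) (A : C) : Prop :=
  ∃ (K G : ℕ → C) (f : ∀ n : ℕ, K n ⟶ G n) (g : ∀ n : ℕ, G n ⟶ K (n + 1))
    (h : ∀ n : ℕ, K (n + 1) ⟶ (K n)⟦(1 : ℤ)⟧),
    K 0 = A ∧ ∀ n : ℕ, X (G n) ∧ Triangle.mk (f n) (g n) (h n) ∈ S ∧
      ∀ Q : C, Y Q → ContraExact (Triangle.mk (f n) (g n) (h n)) Q

/-- A finite `ξ`-exact sequence `0 → Gₙ → ⋯ → G₀ → A → 0` where the `j`-th term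
satisfies the predicate `X j`. -/
def FiniteRes (S : Set (Triangle C)) (n : ℕ) (X : ℕ → C → Prop) (A : C) : Prop :=
  ∃ (K G : ℕ → C) (f : ∀ j : ℕ, K (j + 1) ⟶ G j) (g : ∀ j : ℕ, G j ⟶ K j)
    (h : ∀ j : ℕ, K j ⟶ (K (j + 1))⟦(1 : ℤ)⟧),
    K 0 = A ∧ IsZero (K (n + 1)) ∧
    ∀ j ≤ n, X j (G j) ∧ Triangle.mk (f j) (g j) (h j) ∈ S

/-- `ξ`-Gorenstein projective dimension of `A` is at most `n`. -/
def GpdLE (S : Set (Triangle C)) (A : C) (n : ℕ) : Prop :=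
  FiniteRes S n (fun _ => GProjective S) A

section Exactness

variable {X Y Z W : C}

lemma exists_lift₃ {f : X ⟶ Y} {g : Y ⟶ Z} {h : Z ⟶ X⟦(1 : ℤ)⟧}
    (hT : Triangle.mk f g h ∈ distTriang C) (p : W ⟶ Z) (hp : p ≫ h = 0) :
    ∃ q : W ⟶ Y, p = q ≫ g :=
  Triangle.coyoneda_exact₃ _ hT p hp

lemma exists_lift₁ {f : X ⟶ Y} {g : Y ⟶ Z} {h : Z ⟶ X⟦(1 : ℤ)⟧}
    (hT : Triangle.mk f g h ∈ distTriang C) (p : W ⟶ X⟦(1 : ℤ)⟧)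
    (hp : p ≫ f⟦(1 : ℤ)⟧' = 0) : ∃ q : W ⟶ Z, p = q ≫ h :=
  Triangle.coyoneda_exact₁ _ hT p hp

lemma exists_desc₃ {f : X ⟶ Y} {g : Y ⟶ Z} {h : Z ⟶ X⟦(1 : ℤ)⟧}
    (hT : Triangle.mk f g h ∈ distTriang C) (p : Z ⟶ W) (hp : g ≫ p = 0) :
    ∃ q : X⟦(1 : ℤ)⟧ ⟶ W, p = h ≫ q :=
  Triangle.yoneda_exact₃ _ hT p hp

lemma exists_desc₁ {f : X ⟶ Y} {g : Y ⟶ Z} {h : Z ⟶ X⟦(1 : ℤ)⟧}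
    (hT : Triangle.mk f g h ∈ distTriang C) (p : X⟦(1 : ℤ)⟧ ⟶ W) (hp : h ≫ p = 0) :
    ∃ q : Y⟦(1 : ℤ)⟧ ⟶ W, p = f⟦(1 : ℤ)⟧' ≫ q := by
  obtain ⟨q, hq⟩ : ∃ q : Y⟦(1 : ℤ)⟧ ⟶ W, p = (-f⟦(1 : ℤ)⟧') ≫ q :=
    Triangle.yoneda_exact₃ _ (rot_of_distTriang _ hT) p hp
  exact ⟨-q, by simpa using hq⟩

lemma comp_shift_eq_zero {f : X ⟶ Y} {g : Y ⟶ Z} {h : Z ⟶ X⟦(1 : ℤ)⟧}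
    (hT : Triangle.mk f g h ∈ distTriang C) : h ≫ f⟦(1 : ℤ)⟧' = 0 :=
  comp_distTriang_mor_zero₃₁ _ hT

lemma rotate_distinguished {f : X ⟶ Y} {g : Y ⟶ Z} {h : Z ⟶ X⟦(1 : ℤ)⟧}
    (hT : Triangle.mk f g h ∈ distTriang C) :
    Triangle.mk g h (-f⟦(1 : ℤ)⟧') ∈ distTriang C :=
  rot_of_distTriang _ hT

lemma distinguished_of_rotate {f : X ⟶ Y} {g : Y ⟶ Z} {h : Z ⟶ X⟦(1 : ℤ)⟧}
    (hT : Triangle.mk g h (-f⟦(1 : ℤ)⟧') ∈ distTriang C) :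
    Triangle.mk f g h ∈ distTriang C :=
  (rotate_distinguished_triangle _).2 hT

lemma distinguished_of_iso {X' Y' Z' : C} {f : X ⟶ Y} {g : Y ⟶ Z} {h : Z ⟶ X⟦(1 : ℤ)⟧}
    {f' : X' ⟶ Y'} {g' : Y' ⟶ Z'} {h' : Z' ⟶ X'⟦(1 : ℤ)⟧}
    (hT : Triangle.mk f g h ∈ distTriang C) (e₁ : X' ≅ X) (e₂ : Y' ≅ Y) (e₃ : Z' ≅ Z)
    (h₁ : f' ≫ e₂.hom = e₁.hom ≫ f) (h₂ : g' ≫ e₃.hom = e₂.hom ≫ g)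
    (h₃ : h' ≫ e₁.hom⟦(1 : ℤ)⟧' = e₃.hom ≫ h) : Triangle.mk f' g' h' ∈ distTriang C :=
  isomorphic_distinguished _ hT _ (Triangle.isoMk _ _ e₁ e₂ e₃ h₁ h₂ h₃)

lemma inr_fst_distinguished (X Y : C) :
    Triangle.mk (biprod.inr : X ⟶ Y ⊞ X) biprod.fst 0 ∈ distTriang C :=
  distinguished_of_iso (binaryBiproductTriangle_distinguished X Y) (Iso.refl _)
    (biprod.braiding _ _) (Iso.refl _) (by ext <;> simp) (by ext <;> simp) (by simp)

lemma exists_unrotate {g : Y ⟶ Z} {h : Z ⟶ X⟦(1 : ℤ)⟧} {k : X⟦(1 : ℤ)⟧ ⟶ Y⟦(1 : ℤ)⟧}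
    (hT : Triangle.mk g h k ∈ distTriang C) :
    ∃ f : X ⟶ Y, Triangle.mk f g h ∈ distTriang C := by
  obtain ⟨f, rfl⟩ := (shiftFunctor C (1 : ℤ)).map_surjective k
  refine ⟨-f, distinguished_of_rotate ?_⟩
  rwa [Functor.map_neg, neg_neg]

end Exactness

section Phantom

/-- A morphism is phantom if it is annihilated by precomposition with every morphism
from a `ξ`-projective object. -/
def Phantom (S : Set (Triangle C)) {X Y : C} (h : X ⟶ Y) : Prop :=
  ∀ Q : C, XiProjective S Q → ∀ p : Q ⟶ X, p ≫ h = 0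

/-- A morphism is cophantom if it is annihilated by postcomposition with every morphism
to a `ξ`-projective object. -/
def Cophantom (S : Set (Triangle C)) {X Y : C} (h : X ⟶ Y) : Prop :=
  ∀ Q : C, XiProjective S Q → ∀ r : Y ⟶ Q, h ≫ r = 0

variable {S : Set (Triangle C)}

lemma Phantom.comp_left {X Y Z : C} {h : Y ⟶ Z} (hh : Phantom S h) (u : X ⟶ Y) :
    Phantom S (u ≫ h) := fun Q hQ p => by
  rw [← Category.assoc]; exact hh Q hQ _

lemma Phantom.comp_right {X Y Z : C} {h : X ⟶ Y} (hh : Phantom S h) (u : Y ⟶ Z) :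
    Phantom S (h ≫ u) := fun Q hQ p => by
  rw [← Category.assoc, hh Q hQ, zero_comp]

lemma Cophantom.comp_left {X Y Z : C} {h : Y ⟶ Z} (hh : Cophantom S h) (u : X ⟶ Y) :
    Cophantom S (u ≫ h) := fun Q hQ p => by
  rw [Category.assoc, hh Q hQ, comp_zero]

lemma Cophantom.comp_right {X Y Z : C} {h : X ⟶ Y} (hh : Cophantom S h) (u : Y ⟶ Z) :
    Cophantom S (h ≫ u) := fun Q hQ p => by
  rw [Category.assoc]; exact hh Q hQ _

lemma phantom_of_coExact {T : Triangle C} (hT : T ∈ distTriang C)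
    (hc : ∀ Q : C, XiProjective S Q → CoExact T Q) : Phantom S T.mor₃ := fun Q hQ p => by
  obtain ⟨q, rfl⟩ := (hc Q hQ).2.2 p
  simp [comp_distTriang_mor_zero₂₃ T hT]

lemma phantom_of_mem (hS : IsProperClass S) {T : Triangle C} (hT : T ∈ S) :
    Phantom S T.mor₃ :=
  phantom_of_coExact (hS.subset_dist hT) fun _ hQ => hQ T hT

lemma cophantom_of_contraExact {T : Triangle C} (hT : T ∈ distTriang C)
    (hc : ∀ Q : C, XiProjective S Q → ContraExact T Q) : Cophantom S T.mor₃ :=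
  fun Q hQ r => (hc Q hQ).1 (by
    simp only [comp_zero]
    rw [← Category.assoc, comp_distTriang_mor_zero₂₃ T hT, zero_comp])

lemma comp_shift_mor₃_eq_zero (hS : IsProperClass S) {Q : C}
    (hQ : ∀ T ∈ S, ∀ p : Q ⟶ T.obj₃, p ≫ T.mor₃ = 0) {T : Triangle C} (hT : T ∈ S)
    (y : Q ⟶ T.obj₃⟦(-1 : ℤ)⟧) : y ≫ T.mor₃⟦(-1 : ℤ)⟧' = 0 := by
  have h : y ≫ ((-1 : ℤ).negOnePow • T.mor₃⟦(-1 : ℤ)⟧' ≫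
      (shiftFunctorComm C 1 (-1)).hom.app T.obj₁) = 0 :=
    hQ _ (hS.susp_closed T hT (-1)) y
  rw [← cancel_mono ((shiftFunctorComm C 1 (-1)).hom.app T.obj₁)]
  simpa using h

lemma xiProjective_iff (hS : IsProperClass S) {Q : C} :
    XiProjective S Q ↔ ∀ T ∈ S, ∀ p : Q ⟶ T.obj₃, p ≫ T.mor₃ = 0 := by
  constructor
  · intro hQ T hT p
    exact phantom_of_mem hS hT Q hQ p
  · intro hQ T hT
    have hd := hS.subset_dist hT
    refine ⟨fun φ₁ φ₂ hφ => ?_, fun φ hφ => Triangle.coyoneda_exact₂ T hd φ hφ, fun p => ?_⟩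
    · rw [← sub_eq_zero]
      have h : (φ₁ - φ₂) ≫ T.mor₁ = 0 := by
        rw [Preadditive.sub_comp]
        exact sub_eq_zero.2 hφ
      obtain ⟨y, hy⟩ : ∃ y : Q ⟶ T.obj₃⟦(-1 : ℤ)⟧,
          φ₁ - φ₂ = y ≫ (-T.mor₃⟦(-1 : ℤ)⟧' ≫ (shiftShiftNeg T.obj₁ (1 : ℤ)).hom) :=
        Triangle.coyoneda_exact₂ _ (inv_rot_of_distTriang T hd) (φ₁ - φ₂) h
      have h0 := comp_shift_mor₃_eq_zero hS hQ hT y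
      rw [hy, Preadditive.comp_neg, ← Category.assoc, h0, zero_comp, neg_zero]
    · obtain ⟨q, hq⟩ := Triangle.coyoneda_exact₃ T hd p (hQ T hT p)
      exact ⟨q, hq.symm⟩

lemma XiProjective.shift (hS : IsProperClass S) {Q : C} (hQ : XiProjective S Q) :
    XiProjective S (Q⟦(1 : ℤ)⟧) := by
  rw [xiProjective_iff hS] at hQ ⊢
  intro T hT p
  have h := comp_shift_mor₃_eq_zero hS hQ hT ((shiftShiftNeg Q (1 : ℤ)).inv ≫ p⟦(-1 : ℤ)⟧')
  apply (shiftFunctor C (-1 : ℤ)).map_injective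
  rw [← cancel_epi (shiftShiftNeg Q (1 : ℤ)).inv, Functor.map_comp, Functor.map_zero, comp_zero,
    ← Category.assoc]
  exact h

lemma XiProjective.biprod (hS : IsProperClass S) {P Q : C} (hP : XiProjective S P)
    (hQ : XiProjective S Q) : XiProjective S (P ⊞ Q) := by
  rw [xiProjective_iff hS] at hP hQ ⊢
  intro T hT p
  apply biprod.hom_ext'
  · simpa using hP T hT (biprod.inl ≫ p)
  · simpa using hQ T hT (biprod.inr ≫ p)

lemma mem_of_phantom (hS : IsProperClass S) (hE : HasEnoughXiProjectives S) {T : Triangle C}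
    (hT : T ∈ distTriang C) (h : Phantom S T.mor₃) : T ∈ S := by
  obtain ⟨K, P, f, g, ζ, hP, hm⟩ := hE T.obj₃
  obtain ⟨c, hc⟩ := exists_desc₃ (hS.subset_dist hm) T.mor₃ (h P hP g)
  obtain ⟨c, rfl⟩ := (shiftFunctor C (1 : ℤ)).map_surjective c
  obtain ⟨F, f', g', h', -, hm', -, -, hh⟩ : ∃ (F : C) (f' : T.obj₁ ⟶ F) (g' : F ⟶ T.obj₃)
      (h' : T.obj₃ ⟶ T.obj₁⟦(1 : ℤ)⟧) (β : P ⟶ F), Triangle.mk f' g' h' ∈ S ∧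
        f ≫ β = c ≫ f' ∧ g = β ≫ g' ∧ ζ ≫ c⟦(1 : ℤ)⟧' = h' := hS.cobase_change _ hm c
  refine hS.iso_closed _ _ ⟨isoTriangleOfIso₁₃ _ _ (hS.subset_dist hm') hT
    (Iso.refl _) (Iso.refl _) ?_⟩ hm'
  change h' ≫ (𝟙 T.obj₁)⟦(1 : ℤ)⟧' = 𝟙 T.obj₃ ≫ T.mor₃
  rw [CategoryTheory.Functor.map_id, Category.comp_id, Category.id_comp, ← hh]
  exact hc.symm

lemma contraExact_of_cophantom (hS : IsProperClass S) {T : Triangle C}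
    (hT : T ∈ distTriang C) (h : Cophantom S T.mor₃) {Q : C} (hQ : XiProjective S Q) :
    ContraExact T Q := by
  refine ⟨fun φ₁ φ₂ hφ => ?_, fun φ hφ => Triangle.yoneda_exact₂ T hT φ hφ, fun φ => ?_⟩
  · rw [← sub_eq_zero]
    obtain ⟨r, hr⟩ := Triangle.yoneda_exact₃ T hT (φ₁ - φ₂) (by
      rw [Preadditive.comp_sub]
      exact sub_eq_zero.2 hφ)
    rw [hr, h Q hQ]
  · obtain ⟨r, hr⟩ := exists_desc₁ (f := T.mor₁) hT (φ⟦(1 : ℤ)⟧') (h _ (hQ.shift hS) _)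
    obtain ⟨r, rfl⟩ := (shiftFunctor C (1 : ℤ)).map_surjective r
    refine ⟨r, (shiftFunctor C (1 : ℤ)).map_injective ?_⟩
    rw [Functor.map_comp]
    exact hr.symm

lemma phantom_of_exists_lift {T : Triangle C} (hT : T ∈ distTriang C)
    (h : ∀ Q : C, XiProjective S Q → ∀ p : Q ⟶ T.obj₃, ∃ q : Q ⟶ T.obj₂, p = q ≫ T.mor₂) :
    Phantom S T.mor₃ := fun Q hQ p => by
  obtain ⟨q, rfl⟩ := h Q hQ p
  simp [comp_distTriang_mor_zero₂₃ T hT]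

lemma cophantom_of_cancel {T : Triangle C} (hT : T ∈ distTriang C)
    (h : ∀ Q : C, XiProjective S Q → ∀ ψ : T.obj₃ ⟶ Q, T.mor₂ ≫ ψ = 0 → ψ = 0) :
    Cophantom S T.mor₃ := fun Q hQ r => h Q hQ _ (by
  rw [← Category.assoc, comp_distTriang_mor_zero₂₃ T hT, zero_comp])

section Composition

variable {A B D E F G : C}

lemma phantom_comp_inflation {a : A ⟶ B} {b : B ⟶ D} {v : B ⟶ E} {w : D ⟶ F}
    {h : E ⟶ A⟦(1 : ℤ)⟧} {h' : F ⟶ B⟦(1 : ℤ)⟧} {x : D ⟶ G} {h'' : G ⟶ A⟦(1 : ℤ)⟧}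
    (h₁ : Triangle.mk a v h ∈ distTriang C) (h₂ : Triangle.mk b w h' ∈ distTriang C)
    (h₃ : Triangle.mk (a ≫ b) x h'' ∈ distTriang C) (hh : Phantom S h) (hh' : Phantom S h') :
    Phantom S h'' := fun Q hQ p => by
  have h0 : h'' ≫ a⟦(1 : ℤ)⟧' ≫ b⟦(1 : ℤ)⟧' = 0 := by
    rw [← Functor.map_comp]
    exact comp_shift_eq_zero h₃
  obtain ⟨z, hz⟩ := exists_lift₁ h₂ (p ≫ h'' ≫ a⟦(1 : ℤ)⟧')
    (by simp [h0])
  obtain ⟨z', hz'⟩ := exists_lift₁ h₁ (p ≫ h'')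
    (by rw [Category.assoc, hz, hh' Q hQ z])
  exact hz'.trans (hh Q hQ z')

lemma cophantom_comp_inflation {a : A ⟶ B} {b : B ⟶ D} {v : B ⟶ E} {w : D ⟶ F}
    {h : E ⟶ A⟦(1 : ℤ)⟧} {h' : F ⟶ B⟦(1 : ℤ)⟧} {x : D ⟶ G} {h'' : G ⟶ A⟦(1 : ℤ)⟧}
    (h₁ : Triangle.mk a v h ∈ distTriang C) (h₂ : Triangle.mk b w h' ∈ distTriang C)
    (h₃ : Triangle.mk (a ≫ b) x h'' ∈ distTriang C) (hh : Cophantom S h)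
    (hh' : Cophantom S h') : Cophantom S h'' := fun Q hQ r => by
  have h0 : h'' ≫ a⟦(1 : ℤ)⟧' ≫ b⟦(1 : ℤ)⟧' = 0 := by
    rw [← Functor.map_comp]
    exact comp_shift_eq_zero h₃
  obtain ⟨z, hz⟩ := exists_desc₁ h₁ r (hh Q hQ r)
  obtain ⟨z', hz'⟩ := exists_desc₁ h₂ z (hh' Q hQ z)
  rw [hz, hz', reassoc_of% h0, zero_comp]

lemma phantom_comp_deflation {s : A ⟶ E} {w : E ⟶ F} {h₂ : F ⟶ A⟦(1 : ℤ)⟧}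
    {t : B ⟶ D} {u : D ⟶ E} {h₁ : E ⟶ B⟦(1 : ℤ)⟧} {β : G ⟶ D} {α : F ⟶ G⟦(1 : ℤ)⟧}
    (ht₂ : Triangle.mk s w h₂ ∈ distTriang C) (ht₁ : Triangle.mk t u h₁ ∈ distTriang C)
    (ht : Triangle.mk β (u ≫ w) α ∈ distTriang C) (hh₁ : Phantom S h₁) (hh₂ : Phantom S h₂) :
    Phantom S α :=
  phantom_of_exists_lift ht fun Q hQ p => by
    obtain ⟨q, rfl⟩ := exists_lift₃ ht₂ p (hh₂ Q hQ p)
    obtain ⟨q, rfl⟩ := exists_lift₃ ht₁ q (hh₁ Q hQ q)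
    exact ⟨q, Category.assoc q u w⟩

lemma cophantom_comp_deflation {s : A ⟶ E} {w : E ⟶ F} {h₂ : F ⟶ A⟦(1 : ℤ)⟧}
    {t : B ⟶ D} {u : D ⟶ E} {h₁ : E ⟶ B⟦(1 : ℤ)⟧} {β : G ⟶ D} {α : F ⟶ G⟦(1 : ℤ)⟧}
    (ht₂ : Triangle.mk s w h₂ ∈ distTriang C) (ht₁ : Triangle.mk t u h₁ ∈ distTriang C)
    (ht : Triangle.mk β (u ≫ w) α ∈ distTriang C) (hh₁ : Cophantom S h₁)
    (hh₂ : Cophantom S h₂) : Cophantom S α :=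
  cophantom_of_cancel ht fun Q hQ ψ hψ => by
    obtain ⟨r, hr⟩ := exists_desc₃ ht₁ (w ≫ ψ) ((Category.assoc u w ψ).symm.trans hψ)
    obtain ⟨r', hr'⟩ := exists_desc₃ ht₂ ψ (hr.trans (hh₁ Q hQ r))
    exact hr'.trans (hh₂ Q hQ r')

end Composition

end Phantom

section Resolution

/-- `K` is a syzygy of `A` with respect to a triangle in `S` with `ξ`-projective middle term
which is exact under `Hom(-, Q)` for all `ξ`-projective `Q`. -/
def IsSyzygy (S : Set (Triangle C)) (A K : C) : Prop :=
  ∃ (P : C) (f : K ⟶ P) (g : P ⟶ A) (h : A ⟶ K⟦(1 : ℤ)⟧),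
    XiProjective S P ∧ Triangle.mk f g h ∈ distTriang C ∧ Phantom S h ∧ Cophantom S h

variable {S : Set (Triangle C)}

lemma gProjective_iff (hS : IsProperClass S) (hE : HasEnoughXiProjectives S) {A : C} :
    GProjective S A ↔ ∃ K : ℤ → C, K 0 = A ∧ ∀ n : ℤ, IsSyzygy S (K n) (K (n + 1)) := by
  constructor
  · rintro ⟨K, P, f, g, h, h0, hK⟩
    refine ⟨K, h0, fun n => ⟨P n, f n, g n, h n, (hK n).1, hS.subset_dist (hK n).2.1,
      phantom_of_mem hS (hK n).2.1,
      cophantom_of_contraExact (hS.subset_dist (hK n).2.1) (hK n).2.2⟩⟩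
  · rintro ⟨K, h0, hK⟩
    choose P f g h hP hT hph hco using hK
    exact ⟨K, P, f, g, h, h0, fun n => ⟨hP n, mem_of_phantom hS hE (hT n) (hph n),
      fun Q hQ => contraExact_of_cophantom hS (hT n) (hco n) hQ⟩⟩

lemma GProjective.exists_syzygy (hS : IsProperClass S) (hE : HasEnoughXiProjectives S) {A : C}
    (hA : GProjective S A) : ∃ K : C, GProjective S K ∧ IsSyzygy S A K := by
  obtain ⟨K, rfl, hK⟩ := (gProjective_iff hS hE).1 hA
  refine ⟨K (0 + 1), (gProjective_iff hS hE).2 ⟨fun n => K (n + 1), rfl, fun n => hK _⟩, hK 0⟩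

lemma GProjective.exists_cosyzygy (hS : IsProperClass S) (hE : HasEnoughXiProjectives S) {A : C}
    (hA : GProjective S A) : ∃ L : C, GProjective S L ∧ IsSyzygy S L A := by
  obtain ⟨K, rfl, hK⟩ := (gProjective_iff hS hE).1 hA
  refine ⟨K (-1), (gProjective_iff hS hE).2 ⟨fun n => K (n - 1), by simp, fun n => ?_⟩, hK (-1)⟩
  have h := hK (n - 1)
  rwa [show n - 1 + 1 = n + 1 - 1 by ring] at h

lemma gProjective_of_stable (hS : IsProperClass S) (hE : HasEnoughXiProjectives S)
    (X : C → Prop) (hl : ∀ A, X A → ∃ K, X K ∧ IsSyzygy S A K)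
    (hr : ∀ A, X A → ∃ L, X L ∧ IsSyzygy S L A) {A : C} (hA : X A) : GProjective S A := by
  choose l hl₁ hl₂ using hl
  choose r hr₁ hr₂ using hr
  let L : ℕ → {A // X A} := fun n => Nat.rec ⟨A, hA⟩ (fun _ B => ⟨l B.1 B.2, hl₁ _ _⟩) n
  let R : ℕ → {A // X A} := fun n => Nat.rec ⟨A, hA⟩ (fun _ B => ⟨r B.1 B.2, hr₁ _ _⟩) n
  refine (gProjective_iff hS hE).2
    ⟨fun n => match n with
      | Int.ofNat n => (L n).1
      | Int.negSucc n => (R (n + 1)).1, rfl, fun n => ?_⟩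
  match n with
  | Int.ofNat n => exact hl₂ (L n).1 (L n).2
  | Int.negSucc 0 => exact hr₂ (R 0).1 (R 0).2
  | Int.negSucc (n + 1) => exact hr₂ (R (n + 1)).1 (R (n + 1)).2

end Resolution

variable [IsTriangulated C]

section Octahedron

variable {A B D E F : C}

lemma exists_octahedron_inflation {a : A ⟶ B} {b : B ⟶ D} {v : B ⟶ E} {w : D ⟶ F}
    {h : E ⟶ A⟦(1 : ℤ)⟧} {h' : F ⟶ B⟦(1 : ℤ)⟧}
    (h₁ : Triangle.mk a v h ∈ distTriang C) (h₂ : Triangle.mk b w h' ∈ distTriang C) :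
    ∃ (G : C) (x : D ⟶ G) (h'' : G ⟶ A⟦(1 : ℤ)⟧) (m : E ⟶ G) (n : G ⟶ F),
      Triangle.mk (a ≫ b) x h'' ∈ distTriang C ∧
      Triangle.mk m n (h' ≫ v⟦(1 : ℤ)⟧') ∈ distTriang C := by
  obtain ⟨G, x, h'', h₃⟩ := distinguished_cocone_triangle (a ≫ b)
  obtain ⟨o⟩ := IsTriangulated.octahedron_axiom rfl h₁ h₂ h₃
  exact ⟨G, x, h'', o.m₁, o.m₃, h₃, o.mem⟩

lemma exists_octahedron_deflation {s : A ⟶ E} {w : E ⟶ F} {h₂ : F ⟶ A⟦(1 : ℤ)⟧}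
    {t : B ⟶ D} {u : D ⟶ E} {h₁ : E ⟶ B⟦(1 : ℤ)⟧}
    (ht₂ : Triangle.mk s w h₂ ∈ distTriang C) (ht₁ : Triangle.mk t u h₁ ∈ distTriang C) :
    ∃ (G : C) (x : B ⟶ G) (y : G ⟶ A) (β : G ⟶ D) (α : F ⟶ G⟦(1 : ℤ)⟧),
      Triangle.mk x y (s ≫ h₁) ∈ distTriang C ∧ Triangle.mk β (u ≫ w) α ∈ distTriang C := by
  obtain ⟨G, x, y, h₃⟩ := distinguished_cocone_triangle₂ (s ≫ h₁)
  obtain ⟨o⟩ := IsTriangulated.octahedron_axiom rfl ht₂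
    (rotate_distinguished (rotate_distinguished ht₁)) (rotate_distinguished (rotate_distinguished h₃))
  obtain ⟨β, hβ⟩ := (shiftFunctor C (1 : ℤ)).map_surjective o.m₃
  refine ⟨G, x, y, -β, o.m₁, h₃, distinguished_of_rotate (distinguished_of_rotate ?_)⟩
  have h := o.mem
  rw [← hβ, Preadditive.neg_comp, ← Functor.map_comp] at h
  rwa [Functor.map_neg, neg_neg]

lemma biprod_desc_distinguished {X Y Z P V : C} {i : X ⟶ Y} {j : Y ⟶ Z} {k : Z ⟶ X⟦(1 : ℤ)⟧}
    (hT : Triangle.mk i j k ∈ distTriang C) {b : P ⟶ Z} {c : Z ⟶ V} {d : V ⟶ P⟦(1 : ℤ)⟧}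
    (hb : Triangle.mk b c d ∈ distTriang C) {b' : P ⟶ Y} (hb' : b' ≫ j = b) :
    ∃ δ : V ⟶ (X ⊞ P)⟦(1 : ℤ)⟧,
      Triangle.mk (biprod.desc i b') (j ≫ c) δ ∈ distTriang C := by
  obtain ⟨W, v, w, hW⟩ := distinguished_cocone_triangle (biprod.desc i b')
  obtain ⟨o⟩ := IsTriangulated.octahedron_axiom (biprod.inl_desc i b')
    (binaryBiproductTriangle_distinguished X P) hW hT
  have hm : o.m₁ = b := by
    have := o.comm₁
    rw [← cancel_epi (biprod.snd : X ⊞ P ⟶ P)]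
    refine this.trans (biprod.hom_ext' _ _ ?_ ?_)
    · rw [biprod.inl_desc_assoc, biprod.inl_snd_assoc, zero_comp]
      exact comp_distTriang_mor_zero₁₂ _ hT
    · rw [biprod.inr_desc_assoc, biprod.inr_snd_assoc, hb']
  let e := isoTriangleOfIso₁₂ _ _ o.mem hb (Iso.refl _) (Iso.refl _) (by
    change o.m₁ ≫ 𝟙 Z = 𝟙 P ≫ b
    rw [hm, Category.comp_id, Category.id_comp])
  let e₃ : W ≅ V := Triangle.π₃.mapIso e
  have he : o.m₃ ≫ e₃.hom = c := by
    have := e.hom.comm₂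
    exact this.trans (Category.id_comp _)
  refine ⟨e₃.inv ≫ w, distinguished_of_iso hW (Iso.refl _) (Iso.refl _) e₃.symm (by simp) ?_
    (by simp)⟩
  simp [← he, o.comm₃]

end Octahedron

section Extension

variable {S : Set (Triangle C)}

/-- `Y` is an extension of `ξ`-Gorenstein projective objects along a triangle with phantom and
cophantom connecting morphism. -/
def IsGProjectiveExtension (S : Set (Triangle C)) (Y : C) : Prop :=
  ∃ (X Z : C) (i : X ⟶ Y) (j : Y ⟶ Z) (k : Z ⟶ X⟦(1 : ℤ)⟧), GProjective S X ∧
    GProjective S Z ∧ Triangle.mk i j k ∈ distTriang C ∧ Phantom S k ∧ Cophantom S k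

lemma IsGProjectiveExtension.exists_syzygy (hS : IsProperClass S)
    (hE : HasEnoughXiProjectives S) {Y : C} (hY : IsGProjectiveExtension S Y) :
    ∃ K, IsGProjectiveExtension S K ∧ IsSyzygy S Y K := by
  obtain ⟨X, Z, i, j, k, hX, hZ, hT, hk, -⟩ := hY
  obtain ⟨KX, hKX, PX, fX, a, hX', hPX, hTX, hphX, hcoX⟩ := hX.exists_syzygy hS hE
  obtain ⟨KZ, hKZ, PZ, fZ, b, hZ', hPZ, hTZ, hphZ, hcoZ⟩ := hZ.exists_syzygy hS hE
  obtain ⟨b', hb'⟩ := exists_lift₃ hT b (hk _ hPZ _)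
  obtain ⟨δ, hδ⟩ := biprod_desc_distinguished hT (rotate_distinguished hTZ) hb'.symm
  obtain ⟨s, hs⟩ := exists_unrotate hδ
  obtain ⟨ε, hε⟩ := biprod_desc_distinguished (inr_fst_distinguished PZ X) (rotate_distinguished hTX)
    (b' := a ≫ biprod.inl) (by simp)
  obtain ⟨t, ht⟩ := exists_unrotate hε
  obtain ⟨K, x, y, β, α, hK₁, hK₂⟩ := exists_octahedron_deflation hs ht
  exact ⟨K, ⟨KX, KZ, x, y, _, hKX, hKZ, hK₁, (hphX.comp_left _).comp_left _,
      (hcoX.comp_left _).comp_left _⟩,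
    _, β, _, α, hPZ.biprod hS hPX, hK₂,
    phantom_comp_deflation hs ht hK₂ (hphX.comp_left _) (hphZ.comp_left _),
    cophantom_comp_deflation hs ht hK₂ (hcoX.comp_left _) (hcoZ.comp_left _)⟩

lemma IsGProjectiveExtension.exists_cosyzygy (hS : IsProperClass S)
    (hE : HasEnoughXiProjectives S) {Y : C} (hY : IsGProjectiveExtension S Y) :
    ∃ L, IsGProjectiveExtension S L ∧ IsSyzygy S L Y := by
  obtain ⟨X, Z, i, j, k, hX, hZ, hT, -, hk⟩ := hY
  obtain ⟨LX, hLX, PX, a, q, d, hPX, hTX, hphX, hcoX⟩ := hX.exists_cosyzygy hS hE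
  obtain ⟨LZ, hLZ, PZ, b, c, e, hPZ, hTZ, hphZ, hcoZ⟩ := hZ.exists_cosyzygy hS hE
  obtain ⟨b', hb'⟩ := exists_lift₁ hTX k (hk _ (hPX.shift hS) _)
  obtain ⟨δ, hδ⟩ := biprod_desc_distinguished (rotate_distinguished hTX)
    (rotate_distinguished (rotate_distinguished hT)) hb'.symm
  obtain ⟨s, hs⟩ := exists_unrotate hδ
  obtain ⟨ε, hε⟩ := biprod_desc_distinguished (binaryBiproductTriangle_distinguished PX PZ) hTZ
    (b' := b ≫ biprod.inr) (by simp)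
  have hphε : Phantom S ε := phantom_of_exists_lift hε fun Q hQ p => by
    obtain ⟨p', hp'⟩ := exists_lift₃ hTZ p (hphZ Q hQ p)
    refine ⟨p' ≫ biprod.inr, ?_⟩
    change p = (p' ≫ biprod.inr) ≫ biprod.snd ≫ c
    rw [Category.assoc, biprod.inr_snd_assoc]
    exact hp'
  have hcoε : Cophantom S ε := cophantom_of_cancel hε fun Q hQ ψ hψ => by
    have h0 : c ≫ ψ = 0 := by
      rw [← cancel_epi (biprod.snd : PX ⊞ PZ ⟶ PZ), comp_zero]
      exact (Category.assoc _ _ _).symm.trans hψ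
    obtain ⟨r, hr⟩ := exists_desc₃ hTZ ψ h0
    exact hr.trans (hcoZ Q hQ r)
  obtain ⟨L, x, h'', m, n, hL₁, hL₂⟩ := exists_octahedron_inflation hs hε
  exact ⟨L, ⟨LX, LZ, m, n, _, hLX, hLZ, hL₂, hphε.comp_right _, hcoε.comp_right _⟩,
    _, _, x, h'', hPX.biprod hS hPZ, hL₁,
    phantom_comp_inflation hs hε hL₁ (hphX.comp_right _) hphε,
    cophantom_comp_inflation hs hε hL₁ (hcoX.comp_right _) hcoε⟩

lemma IsGProjectiveExtension.gProjective (hS : IsProperClass S)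
    (hE : HasEnoughXiProjectives S) {Y : C} (hY : IsGProjectiveExtension S Y) :
    GProjective S Y :=
  gProjective_of_stable hS hE (IsGProjectiveExtension S)
    (fun _ h => h.exists_syzygy hS hE) (fun _ h => h.exists_cosyzygy hS hE) hY

end Extension

theorem xi_exact_seq_proj_left (S : Set (Triangle C))
    (hS : IsProperClass S) (hE : HasEnoughXiProjectives S)
    (B G₁ G₀ A K : C) (f₁ : B ⟶ G₁) (g₁ : G₁ ⟶ K) (h₁ : K ⟶ B⟦(1 : ℤ)⟧)
    (f₂ : K ⟶ G₀) (g₂ : G₀ ⟶ A) (h₂ : A ⟶ K⟦(1 : ℤ)⟧)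
    (hT₁ : Triangle.mk f₁ g₁ h₁ ∈ S) (hT₂ : Triangle.mk f₂ g₂ h₂ ∈ S)
    (hG₁ : GProjective S G₁) (hG₀ : GProjective S G₀) :
    ∃ (P G₀' K' : C) (f₁' : B ⟶ P) (g₁' : P ⟶ K') (h₁' : K' ⟶ B⟦(1 : ℤ)⟧)
      (f₂' : K' ⟶ G₀') (g₂' : G₀' ⟶ A) (h₂' : A ⟶ K'⟦(1 : ℤ)⟧),
      Triangle.mk f₁' g₁' h₁' ∈ S ∧ Triangle.mk f₂' g₂' h₂' ∈ S ∧
      XiProjective S P ∧ GProjective S G₀' := by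
  obtain ⟨L, hL, P, a, q, l, hP, hTL, hphl, hcol⟩ := hG₁.exists_cosyzygy hS hE
  obtain ⟨K', g₁', h₁', κ, μ, hT₁', hK'⟩ :=
    exists_octahedron_inflation (hS.subset_dist hT₁) hTL
  obtain ⟨G₀', f₂', g₂', β, α, hT₂', hG₀'⟩ := exists_octahedron_deflation
    (rotate_distinguished (rotate_distinguished (hS.subset_dist hT₂))) (rotate_distinguished hK')
  obtain ⟨γ, hγ⟩ := exists_unrotate hG₀'
  refine ⟨P, G₀', K', _, g₁', h₁', f₂', g₂', _,
    mem_of_phantom hS hE hT₁' (phantom_comp_inflation (hS.subset_dist hT₁) hTL hT₁'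
      (phantom_of_mem hS hT₁) hphl),
    mem_of_phantom hS hE hT₂' ((phantom_of_mem hS hT₂).comp_right _), hP, ?_⟩
  exact IsGProjectiveExtension.gProjective hS hE ⟨G₀, L, γ, β, _, hG₀, hL, hγ,
    (hphl.comp_right _).comp_right _, (hcol.comp_right _).comp_right _⟩


end GorensteinTriangulated
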